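/- arXiv:2408.06446 — 4 statements merged into one kernel-verified Lean document; each statement's English description precedes it below -/
import Mathlib

section
/- Let (Z,d,ν) be a bounded metric measure space with diam(Z) > 0, let D > 0, and suppose there is a constant 0 < c ≤ 1 such that c·r^D ≤ ν(B̄(ξ,r)) for every ξ ∈ Z and every 0 ≤ r ≤ diam(Z), where B̄(ξ,r) is the closed ball of radius r about ξ. Then for every measurable set E ⊆ Z with ν(E) > 0 and every ξ ∈ Z one has ∫_{Z∖E} d(ξ,η)^{−D} dν(η) ≥ −c·log(ν(E)) + c·D·log(diam(Z)) + c·log(c). -/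
open MeasureTheory Metric ENNReal

/-- The integral of `c / t - m` over `[a, b]`, as a Lebesgue integral, when the integrand is
nonnegative. -/
lemma lintegral_Ioc_const_div_sub {a b c m : ℝ} (ha : 0 < a) (hab : a ≤ b)
    (hpos : ∀ t, a < t → t ≤ b → 0 ≤ c / t - m) :
    ∫⁻ t in Set.Ioc a b, ENNReal.ofReal (c / t - m)
      = ENNReal.ofReal (c * Real.log (b / a) - m * (b - a)) := by
  have h0 : (0 : ℝ) ∉ Set.uIcc a b := by
    rw [Set.uIcc_of_le hab]
    exact fun h => absurd h.1 (not_le.2 ha)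
  have hinv : IntervalIntegrable (fun t : ℝ => c * t⁻¹) volume a b :=
    (intervalIntegral.intervalIntegrable_inv (fun x hx h => h0 (h ▸ hx))
      continuousOn_id).const_mul c
  have hint : IntervalIntegrable (fun t : ℝ => c / t - m) volume a b := by
    simpa only [div_eq_mul_inv] using hinv.sub intervalIntegrable_const
  rw [← ofReal_integral_eq_lintegral_ofReal
    ((intervalIntegrable_iff_integrableOn_Ioc_of_le hab).1 hint)
    (ae_restrict_of_forall_mem measurableSet_Ioc fun t ht => hpos t ht.1 ht.2),
    ← intervalIntegral.integral_of_le hab]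
  simp only [div_eq_mul_inv c]
  rw [intervalIntegral.integral_sub hinv intervalIntegrable_const,
    intervalIntegral.integral_const_mul, integral_inv h0, intervalIntegral.integral_const,
    smul_eq_mul, mul_comm (b - a)]

/-- Layer-cake lower bound for the integral of `d(ξ, ·)^{-D}`: the superlevel set at height `t`
is the closed ball of radius `t^{-1/D}`. -/
lemma lintegral_meas_closedBall_le {Z : Type*} [MetricSpace Z] [MeasurableSpace Z] [BorelSpace Z]
    (μ : Measure Z) {D b : ℝ} (hD : 0 < D) (hb : 0 < b) (ξ : Z) :
    ∫⁻ t in Set.Ioc 0 b, μ (closedBall ξ (t ^ (-D⁻¹))) ≤ ∫⁻ η, (edist ξ η) ^ (-D) ∂μ := by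
  set ρ : ℝ := b ^ (-D⁻¹) with hρ
  have hρ0 : 0 < ρ := Real.rpow_pos_of_pos hb _
  have hmax (η : Z) : 0 < max (dist ξ η) ρ := lt_max_of_lt_right hρ0
  let f : Z → ℝ := fun η => (max (dist ξ η) ρ) ^ (-D)
  have hf0 (η : Z) : 0 ≤ f η := (Real.rpow_pos_of_pos (hmax η) _).le
  have hfc : Continuous f :=
    ((continuous_const.dist continuous_id).max continuous_const).rpow_const
      fun η => Or.inl (hmax η).ne'
  have hfle (η : Z) : ENNReal.ofReal (f η) ≤ (edist ξ η) ^ (-D) := by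
    rw [← ENNReal.ofReal_rpow_of_pos (hmax η), edist_dist, ENNReal.rpow_neg, ENNReal.rpow_neg,
      ENNReal.inv_le_inv]
    exact ENNReal.rpow_le_rpow (ENNReal.ofReal_le_ofReal (le_max_left _ _)) hD.le
  have hsub (t : ℝ) (ht : t ∈ Set.Ioc 0 b) :
      μ (closedBall ξ (t ^ (-D⁻¹))) ≤ μ {η | t ≤ f η} := by
    refine measure_mono fun η hη => ?_
    have hle : max (dist ξ η) ρ ≤ t ^ (-D⁻¹) :=
      max_le (by simpa [dist_comm] using hη)
        (Real.rpow_le_rpow_of_nonpos ht.1 ht.2 (by simpa using hD.le))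
    have h := Real.rpow_le_rpow_of_nonpos (hmax η) hle (neg_nonpos.2 hD.le)
    rwa [← Real.rpow_mul ht.1.le, neg_mul_neg, inv_mul_cancel₀ hD.ne', Real.rpow_one] at h
  calc ∫⁻ t in Set.Ioc 0 b, μ (closedBall ξ (t ^ (-D⁻¹)))
      ≤ ∫⁻ t in Set.Ioc 0 b, μ {η | t ≤ f η} := setLIntegral_mono' measurableSet_Ioc hsub
    _ ≤ ∫⁻ t in Set.Ioi 0, μ {η | t ≤ f η} := lintegral_mono_set fun t ht => ht.1
    _ = ∫⁻ η, ENNReal.ofReal (f η) ∂μ :=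
      (lintegral_eq_lintegral_meas_le μ (ae_of_all _ hf0) hfc.measurable.aemeasurable).symm
    _ ≤ ∫⁻ η, (edist ξ η) ^ (-D) ∂μ := lintegral_mono hfle

/-- If `(Z,d,ν)` is a bounded metric measure space with `diam Z > 0` satisfying the
lower Ahlfors–David regularity bound `c r^D ≤ ν(B̄(ξ,r))` for `0 ≤ r ≤ diam Z`
(where `0 < c ≤ 1`, `D > 0`), then for every measurable `E ⊆ Z` with `ν(E) > 0`
(and finite, so that `log ν(E)` makes sense) and every `ξ ∈ Z`,
`∫_{Z∖E} d(ξ,η)^{-D} dν(η) ≥ -c log ν(E) + c D log diam(Z) + c log c`. -/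
theorem integral_off_set_lower_bound
    {Z : Type*} [MetricSpace Z] [MeasurableSpace Z] [BorelSpace Z]
    (ν : Measure Z) (D : ℝ) (hD : 0 < D)
    (hbdd : Bornology.IsBounded (Set.univ : Set Z))
    (hdiam : 0 < diam (Set.univ : Set Z))
    (c : ℝ) (hc : 0 < c) (hc1 : c ≤ 1)
    (hlow : ∀ (ξ : Z) (r : ℝ), 0 ≤ r → r ≤ diam (Set.univ : Set Z) →
      ENNReal.ofReal (c * r ^ D) ≤ ν (closedBall ξ r))
    (E : Set Z) (hE : MeasurableSet E) (hE0 : 0 < ν E) (hEfin : ν E ≠ ∞) (ξ : Z) :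
    ENNReal.ofReal (-c * Real.log (ν E).toReal
        + c * D * Real.log (diam (Set.univ : Set Z)) + c * Real.log c)
      ≤ ∫⁻ η in Eᶜ, (edist ξ η) ^ (-D) ∂ν := by
  set R : ℝ := diam (Set.univ : Set Z)
  set m : ℝ := (ν E).toReal with hm
  have hm0 : 0 < m := ENNReal.toReal_pos hE0.ne' hEfin
  have hRD : 0 < R ^ D := Real.rpow_pos_of_pos hdiam D
  have hlog : -c * Real.log m + c * D * Real.log R + c * Real.log c
      = c * Real.log (c / m / (R ^ D)⁻¹) := by
    rw [div_inv_eq_mul, Real.log_mul (div_pos hc hm0).ne' hRD.ne',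
      Real.log_div hc.ne' hm0.ne', Real.log_rpow hdiam]
    ring
  rw [hlog]
  set a : ℝ := (R ^ D)⁻¹ with ha
  have ha0 : 0 < a := inv_pos.2 hRD
  have hb0 : 0 < c / m := div_pos hc hm0
  rcases le_or_gt (c / m) a with hba | hab
  · rw [ENNReal.ofReal_of_nonpos]
    · exact zero_le
    · exact mul_nonpos_of_nonneg_of_nonpos hc.le
        (Real.log_nonpos (div_pos hb0 ha0).le ((div_le_one ha0).2 hba))
  have hball (r s : ℝ) (hs : ENNReal.ofReal s ≤ ν (closedBall ξ r)) :
      ENNReal.ofReal (s - m) ≤ ν.restrict Eᶜ (closedBall ξ r) := by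
    rw [ENNReal.ofReal_sub _ hm0.le, hm, ENNReal.ofReal_toReal hEfin,
      Measure.restrict_apply' hE.compl, ← Set.sdiff_eq]
    exact (tsub_le_tsub_right hs _).trans le_measure_sdiff
  have haR : a ^ (-D⁻¹) = R := by
    rw [ha, ← Real.rpow_neg hdiam.le, ← Real.rpow_mul hdiam.le, neg_mul_neg,
      mul_inv_cancel₀ hD.ne', Real.rpow_one]
  have hexp : -D⁻¹ ≤ 0 := by simpa using hD.le
  have hlarge : ∀ t ∈ Set.Ioc 0 a,
      ENNReal.ofReal (c / a - m) ≤ ν.restrict Eᶜ (closedBall ξ (t ^ (-D⁻¹))) := by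
    intro t ht
    refine hball _ _ (le_trans ?_ (measure_mono (closedBall_subset_closedBall
      (haR ▸ Real.rpow_le_rpow_of_nonpos ht.1 ht.2 hexp))))
    simpa [ha] using hlow ξ R hdiam.le le_rfl
  have hsmall : ∀ t ∈ Set.Ioc a (c / m),
      ENNReal.ofReal (c / t - m) ≤ ν.restrict Eᶜ (closedBall ξ (t ^ (-D⁻¹))) := by
    intro t ht
    have ht0 : 0 < t := ha0.trans ht.1
    have h := hlow ξ (t ^ (-D⁻¹)) (Real.rpow_nonneg ht0.le _)
      (haR ▸ Real.rpow_le_rpow_of_nonpos ha0 ht.1.le hexp)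
    rw [← Real.rpow_mul ht0.le, neg_mul, inv_mul_cancel₀ hD.ne', Real.rpow_neg_one] at h
    exact hball _ _ h
  have hca : 0 ≤ c / a - m := by
    rw [sub_nonneg, le_div_iff₀ ha0, mul_comm]
    exact ((lt_div_iff₀ hm0).1 hab).le
  have hct : ∀ t, a < t → t ≤ c / m → 0 ≤ c / t - m := by
    intro t hat htb
    rw [sub_nonneg, le_div_iff₀ (ha0.trans hat), mul_comm]
    exact (le_div_iff₀ hm0).1 htb
  calc ENNReal.ofReal (c * Real.log (c / m / a))
      ≤ ENNReal.ofReal ((c / a - m) * a)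
          + ENNReal.ofReal (c * Real.log (c / m / a) - m * (c / m - a)) := by
        refine le_trans (ENNReal.ofReal_le_ofReal (le_of_eq ?_)) ENNReal.ofReal_add_le
        field_simp
        ring
    _ = (∫⁻ _ in Set.Ioc 0 a, ENNReal.ofReal (c / a - m))
          + ∫⁻ t in Set.Ioc a (c / m), ENNReal.ofReal (c / t - m) := by
        rw [lintegral_Ioc_const_div_sub ha0 hab.le hct, setLIntegral_const, Real.volume_Ioc,
          sub_zero, ENNReal.ofReal_mul hca]
    _ ≤ (∫⁻ t in Set.Ioc 0 a, ν.restrict Eᶜ (closedBall ξ (t ^ (-D⁻¹))))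
          + ∫⁻ t in Set.Ioc a (c / m), ν.restrict Eᶜ (closedBall ξ (t ^ (-D⁻¹))) :=
        add_le_add (setLIntegral_mono' measurableSet_Ioc hlarge)
          (setLIntegral_mono' measurableSet_Ioc hsmall)
    _ = ∫⁻ t in Set.Ioc 0 (c / m), ν.restrict Eᶜ (closedBall ξ (t ^ (-D⁻¹))) := by
        rw [← lintegral_union measurableSet_Ioc (Set.Ioc_disjoint_Ioc_of_le le_rfl),
          Set.Ioc_union_Ioc_eq_Ioc ha0.le hab.le]
    _ ≤ ∫⁻ η in Eᶜ, (edist ξ η) ^ (-D) ∂ν :=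
        lintegral_meas_closedBall_le (ν.restrict Eᶜ) hD hb0 ξ
end

section
/- Let G be an infinite group, V a complex Banach space, and π : G → B(V) a group homomorphism into the invertible bounded linear operators on V which is uniformly bounded (sup_{g∈G} ‖π(g)‖ < ∞) and mixing: for every continuous linear functional θ ∈ V* and every v ∈ V, θ(π(g)v) → 0 along the cofinite filter on G (i.e. as g → ∞). Let W be a normed space containing a nonzero vector, ι : W → V an injective compact linear map, and σ : G → B(W) a group homomorphism such that ι ∘ σ(g) = π(g) ∘ ι for all g ∈ G. Then ‖σ(g)‖ → ∞ along the cofinite filter on G. -/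
open MeasureTheory Filter

/-- If `π` is a mixing, uniformly bounded representation of an infinite group `G` on a
Banach space `V`, and `ι : W → V` is an injective compact intertwiner from a nonzero
normed space `W` carrying a representation `σ` with `ι ∘ σ(g) = π(g) ∘ ι`, then
`‖σ(g)‖ → ∞` as `g → ∞` (along the cofinite filter on `G`). -/
theorem subrep_of_mixing_norm_tendsto_atTop
    {G : Type*} [Group G] [Infinite G]
    {V : Type*} [NormedAddCommGroup V] [NormedSpace ℂ V] [CompleteSpace V]
    {W : Type*} [NormedAddCommGroup W] [NormedSpace ℂ W]
    (π : G →* (V →L[ℂ] V)) (σ : G →* (W →L[ℂ] W))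
    (hub : ∃ M : ℝ, ∀ g : G, ‖π g‖ ≤ M)
    (hmix : ∀ (θ : V →L[ℂ] ℂ) (v : V),
      Tendsto (fun g : G => θ (π g v)) cofinite (nhds 0))
    (ι : W →L[ℂ] V) (hinj : Function.Injective ι)
    (hcpt : IsCompactOperator (ι : W → V))
    (hW : ∃ w : W, w ≠ 0)
    (hint : ∀ (g : G) (w : W), ι (σ g w) = π g (ι w)) :
    Tendsto (fun g : G => ‖σ g‖) cofinite atTop := by
  obtain ⟨M, hM⟩ := hub
  obtain ⟨w, hw⟩ := hW
  by_contra h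
  obtain ⟨C, hC⟩ : ∃ C : ℝ, ∃ᶠ g in cofinite, ‖σ g‖ < C := by
    simpa only [tendsto_atTop, not_forall, not_eventually, not_le] using h
  obtain ⟨K, hK, hKsub⟩ := hcpt.image_closedBall_subset_compact (C * ‖w‖)
  have : NeBot (cofinite ⊓ 𝓟 {g : G | ‖σ g‖ < C}) := frequently_mem_iff_neBot.mp hC
  let u := Ultrafilter.of (cofinite ⊓ 𝓟 {g : G | ‖σ g‖ < C})
  have hu : (u : Filter G) ≤ cofinite ⊓ 𝓟 {g : G | ‖σ g‖ < C} := Ultrafilter.of_le _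
  have hmem : ∀ᶠ g in (u : Filter G), π g (ι w) ∈ K := by
    filter_upwards [le_principal_iff.mp (hu.trans inf_le_right)] with g hg
    rw [← hint]
    refine hKsub ⟨σ g w, ?_, rfl⟩
    rw [mem_closedBall_zero_iff]
    exact (σ g).le_of_opNorm_le (le_of_lt hg) w
  obtain ⟨x, -, hx⟩ := hK.ultrafilter_le_nhds (u.map fun g => π g (ι w))
    (le_principal_iff.mpr hmem)
  have hlim : Tendsto (fun g => π g (ι w)) u (nhds x) := hx
  have hx0 : x = 0 := by
    refine SeparatingDual.eq_zero_of_forall_dual_eq_zero (R := ℂ) fun θ => ?_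
    exact tendsto_nhds_unique ((θ.continuous.tendsto x).comp hlim)
      ((hmix θ (ι w)).mono_left (hu.trans inf_le_left))
  have hbound : ∀ g : G, ‖ι w‖ ≤ M * ‖π g (ι w)‖ := fun g => by
    have hinv : π g⁻¹ (π g (ι w)) = ι w := by
      rw [← mul_apply_eq_comp, ← map_mul, inv_mul_cancel, map_one,
        one_apply_eq_self]
    simpa only [hinv] using (π g⁻¹).le_of_opNorm_le (hM g⁻¹) (π g (ι w))
  have hle : ‖ι w‖ ≤ M * ‖x‖ :=
    ge_of_tendsto (hlim.norm.const_mul M) (Eventually.of_forall hbound)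
  rw [hx0, norm_zero, mul_zero, norm_le_zero_iff, map_eq_zero_iff ι hinj] at hle
  exact hw hle
end

section
/- Let (Z,ν) be a probability space, 1 ≤ p < ∞, and let K, K' : Z×Z → [0,∞] be measurable with K' ≤ K pointwise. Set N(ξ) = ∫_Z K'(ξ,ω) dν(ω), and suppose m := ess inf N > 0 and N(ξ) < ∞ for ν-almost every ξ. Then for every φ ∈ L^p(ν) such that ∫_Z K'(ξ,ω)|φ(ω)| dν(ω) < ∞ for ν-almost every ξ, one has ∫_Z | φ(ξ) − N(ξ)^{−1} ∫_Z K'(ξ,ω) φ(ω) dν(ω) |^p dν(ξ) ≤ m^{−1} · ∬_{Z×Z} |φ(ξ)−φ(ω)|^p · K(ξ,ω) dν(ξ)dν(ω). -/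
open MeasureTheory ENNReal

/-- Jensen's inequality for the distance from a point to the mean. -/
lemma enorm_sub_integral_rpow_le {Ω E : Type*} [MeasurableSpace Ω] [NormedAddCommGroup E]
    [NormedSpace ℝ E] [CompleteSpace E] (P : Measure Ω) [IsProbabilityMeasure P]
    {p : ℝ} (hp : 1 ≤ p) {f : Ω → E} (hf : Integrable f P) (c : E) :
    ‖c - ∫ ω, f ω ∂P‖ₑ ^ p ≤ ∫⁻ ω, ‖c - f ω‖ₑ ^ p ∂P := by
  have hp0 : 0 < p := one_pos.trans_le hp
  have hmean : c - ∫ ω, f ω ∂P = ∫ ω, (c - f ω) ∂P := by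
    rw [integral_sub (integrable_const c) hf, integral_const, probReal_univ, one_smul]
  have hmono := eLpNorm'_le_eLpNorm'_of_exponent_le one_pos hp P
    (aestronglyMeasurable_const.sub hf.aestronglyMeasurable : AEStronglyMeasurable (c - f ·) P)
  simp only [eLpNorm', rpow_one, div_one] at hmono
  calc ‖c - ∫ ω, f ω ∂P‖ₑ ^ p ≤ ((∫⁻ ω, ‖c - f ω‖ₑ ^ p ∂P) ^ (1 / p)) ^ p := by
        rw [hmean]
        gcongr
        exact (enorm_integral_le_lintegral_enorm _).trans hmono
    _ = ∫⁻ ω, ‖c - f ω‖ₑ ^ p ∂P := by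
        rw [← rpow_mul, one_div_mul_cancel hp0.ne', rpow_one]

/-- Jensen's inequality for the distance from a point to a weighted mean. -/
lemma enorm_sub_weighted_integral_rpow_le {Ω E : Type*} [MeasurableSpace Ω]
    [NormedAddCommGroup E] [NormedSpace ℝ E] [CompleteSpace E] (ν : Measure Ω)
    {p : ℝ} (hp : 1 ≤ p) {k : Ω → ℝ≥0∞} (hk : Measurable k)
    (hk0 : ∫⁻ ω, k ω ∂ν ≠ 0) (hkfin : ∫⁻ ω, k ω ∂ν ≠ ∞)
    {f : Ω → E} (hf : StronglyMeasurable f) (hint : ∫⁻ ω, k ω * ‖f ω‖ₑ ∂ν < ∞) (c : E) :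
    ‖c - ((∫⁻ ω, k ω ∂ν).toReal)⁻¹ • ∫ ω, (k ω).toReal • f ω ∂ν‖ₑ ^ p
      ≤ (∫⁻ ω, k ω ∂ν)⁻¹ * ∫⁻ ω, ‖c - f ω‖ₑ ^ p * k ω ∂ν := by
  have hk_lt : ∀ᵐ ω ∂ν, k ω < ∞ := ae_lt_top hk hkfin
  set N := ∫⁻ ω, k ω ∂ν
  have : IsProbabilityMeasure (N⁻¹ • ν.withDensity k) := ⟨by
    rw [Measure.smul_apply, withDensity_apply _ .univ, setLIntegral_univ, smul_eq_mul,
      ENNReal.inv_mul_cancel hk0 hkfin]⟩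
  have hfi : Integrable f (ν.withDensity k) := by
    refine ⟨hf.aestronglyMeasurable, ?_⟩
    rw [hasFiniteIntegral_iff_enorm, lintegral_withDensity_eq_lintegral_mul _ hk hf.enorm]
    exact hint
  have hmeas : Measurable fun ω => ‖c - f ω‖ₑ ^ p :=
    (stronglyMeasurable_const.sub hf).enorm.pow_const p
  have h := enorm_sub_integral_rpow_le (N⁻¹ • ν.withDensity k) hp
    (hfi.smul_measure (ENNReal.inv_ne_top.2 hk0)) c
  rw [integral_smul_measure, integral_withDensity_eq_integral_toReal_smul hk hk_lt,
    lintegral_smul_measure, ENNReal.toReal_inv, smul_eq_mul,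
    lintegral_withDensity_eq_lintegral_mul _ hk hmeas] at h
  simpa only [Pi.mul_apply, mul_comm (k _)] using h

/-- **Averaging estimate.** Let `(Z,ν)` be a probability space, `1 ≤ p < ∞`, and
`K' ≤ K` measurable kernels with values in `[0,∞]`. Set `N(ξ) = ∫ K'(ξ,ω) dν(ω)`,
suppose `m = essinf N > 0` and `N < ∞` a.e. Then for every `φ ∈ Lᵖ(ν)` with
`∫ K'(ξ,ω)|φ(ω)| dν(ω) < ∞` for a.e. `ξ`,
`∫ |φ(ξ) - N(ξ)⁻¹ ∫ K'(ξ,ω) φ(ω) dν(ω)|^p dν(ξ)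
  ≤ m⁻¹ ∬ |φ(ξ)-φ(ω)|^p K(ξ,ω) dν(ξ) dν(ω)`. -/
theorem averaging_estimate
    {Z : Type*} [MeasurableSpace Z] (ν : Measure Z) [IsProbabilityMeasure ν]
    (p : ℝ) (hp : 1 ≤ p)
    (K K' : Z × Z → ℝ≥0∞) (hK : Measurable K) (hK' : Measurable K')
    (hle : ∀ q, K' q ≤ K q)
    (hm : 0 < essInf (fun ξ => ∫⁻ ω, K' (ξ, ω) ∂ν) ν)
    (hNfin : ∀ᵐ ξ ∂ν, (∫⁻ ω, K' (ξ, ω) ∂ν) < ∞)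
    (φ : Z → ℂ) (hφ : Measurable φ)
    (hφp : (∫⁻ ξ, (‖φ ξ‖₊ : ℝ≥0∞) ^ p ∂ν) ≠ ∞)
    (hint : ∀ᵐ ξ ∂ν, (∫⁻ ω, K' (ξ, ω) * (‖φ ω‖₊ : ℝ≥0∞) ∂ν) < ∞) :
    (∫⁻ ξ, (‖φ ξ - ((∫⁻ ω, K' (ξ, ω) ∂ν).toReal)⁻¹ •
        ∫ ω, (K' (ξ, ω)).toReal • φ ω ∂ν‖₊ : ℝ≥0∞) ^ p ∂ν)
      ≤ (essInf (fun ξ => ∫⁻ ω, K' (ξ, ω) ∂ν) ν)⁻¹ *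
        ∫⁻ ξ, ∫⁻ ω, (‖φ ξ - φ ω‖₊ : ℝ≥0∞) ^ p * K (ξ, ω) ∂ν ∂ν := by
  set m := essInf (fun ξ => ∫⁻ ω, K' (ξ, ω) ∂ν) ν
  rw [← lintegral_const_mul' _ _ (ENNReal.inv_ne_top.2 hm.ne')]
  refine lintegral_mono_ae ?_
  filter_upwards [hNfin, hint, ae_essInf_le (μ := ν) (f := fun ξ => ∫⁻ ω, K' (ξ, ω) ∂ν)]
    with ξ hfin hi hmN
  refine (enorm_sub_weighted_integral_rpow_le ν hp (hK'.comp measurable_prodMk_left)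
    (hm.trans_le hmN).ne' hfin.ne hφ.stronglyMeasurable hi (φ ξ)).trans ?_
  exact mul_le_mul' (ENNReal.inv_le_inv.2 hmN)
    (lintegral_mono fun ω => mul_le_mul_right (hle (ξ, ω)) _)
end

section
/- Let (Z,d,ν) be a bounded metric measure space that is Ahlfors–David D-regular for some D > 0, with diam(Z) > 0. For ε > 0 define the kernel K_ε(ξ,ω) = d(ξ,ω)^{−D} if d(ξ,ω) > ε and K_ε(ξ,ω) = 0 otherwise. Then: (a) for every 1 < p < ∞ and every ε > 0, the integral operator T_{K_ε}φ(ξ) = ∫_Z K_ε(ξ,ω)φ(ω) dν(ω) is a compact bounded linear operator on L^p(ν); (b) writing N_ε(ξ) = ∫_Z K_ε(ξ,ω) dν(ω), one has ess inf N_ε → ∞ as ε → 0⁺. -/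
open MeasureTheory Metric Filter Topology ENNReal

theorem isCompactOperator_of_exists_subseq_tendsto {E F : Type*}
    [NormedAddCommGroup E] [NormedSpace ℂ E] [NormedAddCommGroup F] [NormedSpace ℂ F]
    (T : E →L[ℂ] F)
    (h : ∀ x : ℕ → E, (∀ n, ‖x n‖ ≤ 1) →
      ∃ (y : F) (σ : ℕ → ℕ), StrictMono σ ∧ Tendsto (fun n => T (x (σ n))) atTop (𝓝 y)) :
    IsCompactOperator (T : E → F) := by
  refine (isCompactOperator_iff_isCompact_closure_image_closedBall
    (T : E →ₗ[ℂ] F) one_pos).2 (IsSeqCompact.isCompact fun u hu => ?_)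
  have hx : ∀ n, ∃ x : E, ‖x‖ ≤ 1 ∧ dist (u n) (T x) < 1 / ((n : ℝ) + 1) := fun n => by
    obtain ⟨_, ⟨x, hx, rfl⟩, hd⟩ :=
      Metric.mem_closure_iff.1 (hu n) _ (Nat.one_div_pos_of_nat (n := n))
    exact ⟨x, by simpa using hx, hd⟩
  choose x hx1 hxd using hx
  obtain ⟨y, σ, hσ, hy⟩ := h x hx1
  have hd : Tendsto (fun n => dist (T (x (σ n))) (u (σ n))) atTop (𝓝 0) := by
    refine squeeze_zero (fun _ => dist_nonneg) (fun n => ?_)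
      (tendsto_one_div_add_atTop_nhds_zero_nat.comp hσ.tendsto_atTop)
    rw [dist_comm]
    exact (hxd _).le
  have hy' : Tendsto (u ∘ σ) atTop (𝓝 y) := (tendsto_iff_of_dist hd).1 hy
  exact ⟨y, isClosed_closure.mem_of_tendsto hy' (.of_forall fun n => hu _), σ, hσ, hy'⟩

section KernelOperator

variable {Z : Type*} [MeasurableSpace Z] {ν : Measure Z} {p : ℝ≥0∞}

theorem exists_subseq_tendsto_lpPairing [IsSeparable ν] {q : ℝ≥0∞} [Fact (1 ≤ p)] [Fact (1 ≤ q)]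
    [p.HolderConjugate q] (hq : q ≠ ∞)
    (φ : ℕ → Lp ℂ p ν) (hφ : ∀ n, ‖φ n‖ ≤ 1) :
    ∃ (l : Lp ℂ q ν → ℂ) (σ : ℕ → ℕ), StrictMono σ ∧ ∀ g : Lp ℂ q ν,
      Tendsto (fun n => (ContinuousLinearMap.mul ℂ ℂ).lpPairing ν p q (φ (σ n)) g)
        atTop (𝓝 (l g)) := by
  have : Fact (q ≠ ∞) := ⟨hq⟩
  set P := (ContinuousLinearMap.mul ℂ ℂ).lpPairing ν p q
  obtain ⟨l, -, σ, hσ, hl⟩ := WeakDual.isSeqCompact_closedBall ℂ (Lp ℂ q ν) 0 ‖P‖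
    (x := fun n => StrongDual.toWeakDual (P (φ n))) (fun n => by
      have := P.le_opNorm_of_le (hφ n)
      simpa using this)
  exact ⟨l, σ, hσ, fun g => ((WeakDual.eval_continuous g).tendsto l).comp hl⟩

theorem tendsto_eLpNorm_of_bounded_of_tendsto [IsFiniteMeasure ν] {E : Type*} [NormedAddCommGroup E]
    [Fact (1 ≤ p)] (hp : p ≠ ∞) {f : ℕ → Z → E} {g : Z → E} (B : ℝ)
    (hf : ∀ n, StronglyMeasurable (f n))
    (hg : StronglyMeasurable g) (hB : ∀ n x, ‖f n x‖ ≤ B)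
    (h : ∀ x, Tendsto (fun n => f n x) atTop (𝓝 (g x))) :
    Tendsto (fun n => eLpNorm (f n - g) p ν) atTop (𝓝 0) := by
  have hgB : ∀ x, ‖g x‖ ≤ B := fun x => le_of_tendsto (h x).norm (.of_forall fun n => hB n x)
  have hp0 : p ≠ 0 := (zero_lt_one.trans_le (Fact.out : 1 ≤ p)).ne'
  have hpr : 0 < p.toReal := ENNReal.toReal_pos hp0 hp
  simp_rw [eLpNorm_eq_lintegral_rpow_enorm_toReal hp0 hp]
  have hl : Tendsto (fun n => ∫⁻ x, ‖(f n - g) x‖ₑ ^ p.toReal ∂ν) atTop (𝓝 (∫⁻ _, 0 ∂ν)) := by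
    refine tendsto_lintegral_of_dominated_convergence (fun _ => ENNReal.ofReal (2 * B) ^ p.toReal)
      (fun n => (((hf n).sub hg).enorm).pow_const _) (fun n => .of_forall fun x => ?_) ?_
      (.of_forall fun x => ?_)
    · refine ENNReal.rpow_le_rpow ?_ hpr.le
      rw [← ofReal_norm]
      refine ENNReal.ofReal_le_ofReal ((norm_sub_le _ _).trans ?_)
      linarith [hB n x, hgB x]
    · rw [lintegral_const]
      exact ENNReal.mul_ne_top (ENNReal.rpow_ne_top_of_nonneg hpr.le ENNReal.ofReal_ne_top)
        (measure_ne_top _ _)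
    · have h1 : Tendsto (fun n => ‖(f n - g) x‖ₑ) atTop (𝓝 0) := by
        have := ((h x).sub_const (g x)).enorm
        simpa using this
      have := (ENNReal.continuous_rpow_const (y := p.toReal)).tendsto 0 |>.comp h1
      simpa [hpr, Function.comp_def] using this
  have := (ENNReal.continuous_rpow_const (y := 1 / p.toReal)).tendsto _ |>.comp hl
  simpa [hpr, Function.comp_def] using this

theorem exists_compactOperator_of_bounded_kernel [IsFiniteMeasure ν] [IsSeparable ν] {q : ℝ≥0∞}
    [Fact (1 ≤ p)] [Fact (1 ≤ q)] [p.HolderConjugate q] (hp : p ≠ ∞) (hq : q ≠ ∞)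
    (k : Z → Z → ℝ) (hk : Measurable (Function.uncurry k)) (M : ℝ) (hM : ∀ x y, |k x y| ≤ M) :
    ∃ T : Lp ℂ p ν →L[ℂ] Lp ℂ p ν, IsCompactOperator (T : Lp ℂ p ν → Lp ℂ p ν) ∧
      ∀ φ : Lp ℂ p ν, ∀ᵐ ξ ∂ν, (T φ : Z → ℂ) ξ = ∫ ω, k ξ ω • (φ : Z → ℂ) ω ∂ν := by
  have hM' : 0 ≤ max M 0 := le_max_right _ _
  have hkx : ∀ x, MemLp (fun ω => (k x ω : ℂ)) q ν := fun x =>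
    MemLp.of_bound (Complex.measurable_ofReal.comp
      hk.of_uncurry_left).aestronglyMeasurable (max M 0)
      (.of_forall fun y => by simpa using Or.inl (hM x y))
  set P := (ContinuousLinearMap.mul ℂ ℂ).lpPairing ν p q
  let F : Lp ℂ p ν → Z → ℂ := fun φ ξ => ∫ ω, k ξ ω • (φ : Z → ℂ) ω ∂ν
  have hFP : ∀ φ ξ, F φ ξ = P φ ((hkx ξ).toLp _) := fun φ ξ => by
    rw [ContinuousLinearMap.lpPairing_eq_integral]
    refine integral_congr_ae ?_
    filter_upwards [(hkx ξ).coeFn_toLp] with ω hω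
    simp [hω, mul_comm]
  have hFm : ∀ φ, StronglyMeasurable (F φ) := fun φ =>
    StronglyMeasurable.integral_prod_right
      (hk.stronglyMeasurable.smul ((Lp.stronglyMeasurable φ).comp_measurable measurable_snd))
  set A : ℝ := ‖P‖ * ((measureUnivNNReal ν : ℝ) ^ q.toReal⁻¹ * max M 0) with hA
  have hA0 : 0 ≤ A := by positivity
  have hFb : ∀ φ ξ, ‖F φ ξ‖ ≤ A * ‖φ‖ := fun φ ξ => by
    have h1 : ‖(hkx ξ).toLp _‖ ≤ (measureUnivNNReal ν : ℝ) ^ q.toReal⁻¹ * max M 0 := by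
      have := Lp.norm_le_of_ae_bound (f := (hkx ξ).toLp _) hM' (by
        filter_upwards [(hkx ξ).coeFn_toLp] with ω hω
        simpa [hω] using Or.inl (hM ξ ω))
      simpa using this
    rw [hFP]
    calc _ ≤ ‖P‖ * ‖φ‖ * ‖(hkx ξ).toLp _‖ := P.le_opNorm₂ _ _
      _ ≤ ‖P‖ * ‖φ‖ * ((measureUnivNNReal ν : ℝ) ^ q.toReal⁻¹ * max M 0) := by gcongr
      _ = A * ‖φ‖ := by rw [hA]; ring
  have hFL : ∀ φ, MemLp (F φ) p ν := fun φ =>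
    MemLp.of_bound (hFm φ).aestronglyMeasurable _ (.of_forall (hFb φ))
  let T₀ : Lp ℂ p ν →ₗ[ℂ] Lp ℂ p ν :=
    { toFun := fun φ => (hFL φ).toLp _
      map_add' := fun φ ψ => by
        rw [← MemLp.toLp_add]
        congr 1
        ext ξ
        simp [hFP]
      map_smul' := fun a φ => by
        rw [RingHom.id_apply, ← MemLp.toLp_const_smul]
        congr 1
        ext ξ
        simp [hFP] }
  let T : Lp ℂ p ν →L[ℂ] Lp ℂ p ν :=
    T₀.mkContinuous ((measureUnivNNReal ν : ℝ) ^ p.toReal⁻¹ * A) fun φ => by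
      have := Lp.norm_le_of_ae_bound (f := (hFL φ).toLp _) (C := A * ‖φ‖) (by positivity) (by
        filter_upwards [(hFL φ).coeFn_toLp] with ω hω
        rw [hω]
        exact hFb φ ω)
      simpa [T₀, mul_assoc] using this
  refine ⟨T, isCompactOperator_of_exists_subseq_tendsto T fun φ hφ => ?_,
    fun φ => (hFL φ).coeFn_toLp⟩
  obtain ⟨l, σ, hσ, hl⟩ := exists_subseq_tendsto_lpPairing hq φ hφ
  have hlim : ∀ ξ, Tendsto (fun n => F (φ (σ n)) ξ) atTop (𝓝 (l ((hkx ξ).toLp _))) := fun ξ => by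
    simp_rw [hFP]
    exact hl _
  have hb : ∀ n ξ, ‖F (φ (σ n)) ξ‖ ≤ A := fun n ξ =>
    (hFb _ _).trans (mul_le_of_le_one_right hA0 (hφ _))
  have hgm : StronglyMeasurable fun ξ => l ((hkx ξ).toLp _) :=
    stronglyMeasurable_of_tendsto atTop (fun n => hFm (φ (σ n))) (tendsto_pi_nhds.2 hlim)
  have hgL : MemLp (fun ξ => l ((hkx ξ).toLp _)) p ν :=
    MemLp.of_bound hgm.aestronglyMeasurable A
      (.of_forall fun ξ => le_of_tendsto (hlim ξ).norm (.of_forall fun n => hb n ξ))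
  refine ⟨hgL.toLp _, σ, hσ, ?_⟩
  exact (Lp.tendsto_Lp_iff_tendsto_eLpNorm'' _ (fun n => hFL (φ (σ n))) _ hgL).2
    (tendsto_eLpNorm_of_bounded_of_tendsto hp A (fun n => hFm _) hgm hb hlim)

end KernelOperator

theorem secondCountableTopology_of_measure_closedBall_pos {Z : Type*} [MetricSpace Z]
    [MeasurableSpace Z] [BorelSpace Z] (ν : Measure Z) [IsFiniteMeasure ν]
    (h : ∀ (x : Z) (r : ℝ), 0 < r → 0 < ν (closedBall x r)) :
    SecondCountableTopology Z := by
  refine Metric.secondCountable_of_almost_dense_set fun ε hε => ?_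
  obtain ⟨N, hN⟩ : ∃ N : Set Z, Maximal (fun N => N.Pairwise fun x y => ε < dist x y) N := by
    refine zorn_subset _ fun c hc hchain => ⟨⋃₀ c, ?_, fun s => Set.subset_sUnion_of_mem⟩
    exact (Set.pairwise_sUnion hchain.directedOn).2 fun s hs => hc hs
  refine ⟨N, ?_, fun x => ?_⟩
  · have := Measure.countable_meas_pos_of_disjoint_iUnion (μ := ν)
      (As := fun i : N => closedBall (i : Z) (ε / 2)) (fun i => measurableSet_closedBall)
      fun i j hij => closedBall_disjoint_closedBall (by
        have := hN.prop i.2 j.2 (Subtype.coe_injective.ne hij)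
        linarith)
    have hu : {i : N | 0 < ν (closedBall (i : Z) (ε / 2))} = Set.univ :=
      Set.eq_univ_of_forall fun i => h _ _ (half_pos hε)
    rw [hu, Set.countable_univ_iff] at this
    exact Set.countable_coe_iff.1 this
  · by_contra! hx
    have hins : (insert x N).Pairwise fun x y => ε < dist x y :=
      Set.pairwise_insert.2 ⟨hN.prop, fun y hy _ => ⟨hx y hy, by rw [dist_comm]; exact hx y hy⟩⟩
    have hxN : x ∈ N := hN.le_of_ge hins (Set.subset_insert _ _) (Set.mem_insert _ _)
    have := hx x hxN
    rw [dist_self] at this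
    linarith

theorem abs_truncated_kernel_le {Z : Type*} [MetricSpace Z] {D ε : ℝ} (hD : 0 < D) (hε : 0 < ε)
    (ξ ω : Z) :
    |if ε < dist ξ ω then ((edist ξ ω) ^ (-D)).toReal else 0| ≤ ε ^ (-D) := by
  split_ifs with h
  · rw [← ENNReal.toReal_rpow, edist_dist, ENNReal.toReal_ofReal dist_nonneg, abs_of_nonneg
      (Real.rpow_nonneg dist_nonneg _)]
    exact Real.rpow_le_rpow_of_nonpos hε h.le (by linarith)
  · simpa using Real.rpow_nonneg hε.le _

section TruncatedKernel

variable {Z : Type*} [MetricSpace Z] [MeasurableSpace Z] [BorelSpace Z] {ν : Measure Z}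

theorem lintegral_truncated_kernel_add_le {D : ℝ} (hD : 0 < D) {r s a : ℝ} (hr : 0 < r)
    (hsr : s ≤ r) {ξ : Z} (hs : ν (closedBall ξ s) ≠ ∞)
    (h : ENNReal.ofReal (a * r ^ D) + ν (closedBall ξ s) ≤ ν (closedBall ξ r)) :
    (∫⁻ ω, (if r < dist ξ ω then (edist ξ ω) ^ (-D) else 0) ∂ν) + ENNReal.ofReal a ≤
      ∫⁻ ω, (if s < dist ξ ω then (edist ξ ω) ^ (-D) else 0) ∂ν := by
  set S := closedBall ξ r \ closedBall ξ s with hS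
  have hSm : MeasurableSet S := measurableSet_closedBall.diff measurableSet_closedBall
  have hνS : ENNReal.ofReal (a * r ^ D) ≤ ν S := by
    rw [hS, measure_sdiff (closedBall_subset_closedBall hsr)
      measurableSet_closedBall.nullMeasurableSet hs]
    exact ENNReal.le_sub_of_add_le_right hs h
  have hmass : ENNReal.ofReal a ≤ ∫⁻ ω, S.indicator (fun _ => ENNReal.ofReal (r ^ (-D))) ω ∂ν := by
    rw [lintegral_indicator_const hSm]
    calc ENNReal.ofReal a = ENNReal.ofReal (r ^ (-D)) * ENNReal.ofReal (a * r ^ D) := by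
          rw [← ENNReal.ofReal_mul (by positivity), mul_left_comm, ← Real.rpow_add hr]
          simp
      _ ≤ _ := by gcongr
  refine (add_le_add_right hmass _).trans ?_
  rw [← lintegral_add_right _ (measurable_const.indicator hSm)]
  refine lintegral_mono fun ω => ?_
  by_cases h1 : r < dist ξ ω
  · have h2 : ω ∉ S := fun hω => by
      have := mem_closedBall'.1 hω.1
      linarith
    simp [h1, h2, hsr.trans_lt h1]
  · by_cases h2 : s < dist ξ ω
    · have h3 : ω ∈ S := ⟨mem_closedBall'.2 (not_lt.1 h1), fun h => (mem_closedBall'.1 h).not_gt h2⟩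
      simp only [h1, h2, h3, if_true, if_false, Set.indicator_of_mem, zero_add]
      rw [← ENNReal.ofReal_rpow_of_pos hr, ENNReal.rpow_neg, ENNReal.rpow_neg,
        ENNReal.inv_le_inv, edist_dist]
      exact ENNReal.rpow_le_rpow (ENNReal.ofReal_le_ofReal (not_lt.1 h1)) hD.le
    · have h3 : ω ∉ S := fun hω => hω.2 (mem_closedBall'.2 (not_lt.1 h2))
      simp [h1, h3, h2]

theorem natCast_mul_le_lintegral_truncated_kernel {D c C R L : ℝ} (hD : 0 < D) (hc : 0 < c)
    (hC : 0 ≤ C) (hR : 0 < R) (hL : 1 ≤ L) (hLD : 2 * C ≤ c * L ^ D)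
    {ξ : Z}
    (hlow : ∀ r : ℝ, 0 ≤ r → r ≤ R → ENNReal.ofReal (c * r ^ D) ≤ ν (closedBall ξ r))
    (hupp : ∀ r : ℝ, 0 ≤ r → r ≤ R → ν (closedBall ξ r) ≤ ENNReal.ofReal (C * r ^ D)) (n : ℕ) :
    ENNReal.ofReal (n * (c / 2)) ≤
      ∫⁻ ω, (if R / L ^ n < dist ξ ω then (edist ξ ω) ^ (-D) else 0) ∂ν := by
  have hL0 : 0 < L := one_pos.trans_le hL
  induction n with
  | zero => simp
  | succ n ih =>
    set r := R / L ^ n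
    have hr : 0 < r := by positivity
    have hrR : r ≤ R := div_le_self hR.le (one_le_pow₀ hL)
    have hs : R / L ^ (n + 1) = r / L := by rw [pow_succ, div_mul_eq_div_div]
    have hsr : r / L ≤ r := div_le_self hr.le hL
    have hs0 : 0 ≤ r / L := by positivity
    have hub := hupp (r / L) hs0 (hsr.trans hrR)
    rw [hs]
    refine le_trans ?_ (lintegral_truncated_kernel_add_le (a := c / 2) hD hr hsr
      (hub.trans_lt ENNReal.ofReal_lt_top).ne ?_)
    · refine le_trans (le_of_eq ?_) (add_le_add_left ih _)
      rw [← ENNReal.ofReal_add (by positivity) (by positivity)]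
      push_cast
      ring_nf
    · refine (add_le_add_right hub _).trans (le_trans ?_ (hlow r hr.le hrR))
      rw [← ENNReal.ofReal_add (by positivity) (by positivity)]
      refine ENNReal.ofReal_le_ofReal ?_
      rw [Real.div_rpow hr.le hL0.le]
      have hrD : 0 < r ^ D := by positivity
      have hLD0 : 0 < L ^ D := by positivity
      have : C * (r ^ D / L ^ D) ≤ c / 2 * r ^ D := by
        rw [← mul_div_assoc, div_le_iff₀ hLD0]
        nlinarith
      linarith

theorem measurable_uncurry_truncated_kernel [SecondCountableTopology Z] (D ε : ℝ) :
    Measurable (Function.uncurry fun ξ ω : Z =>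
      if ε < dist ξ ω then ((edist ξ ω) ^ (-D)).toReal else 0) := by
  refine Measurable.ite (measurableSet_lt measurable_const measurable_dist) ?_ measurable_const
  exact (measurable_edist.pow_const _).ennreal_toReal

end TruncatedKernel


/-- On a bounded Ahlfors–David `D`-regular metric measure space with positive
diameter, the off-diagonal cut-off kernels `K_ε(ξ,ω) = d(ξ,ω)^{-D} 𝟙_{d(ξ,ω)>ε}`
define compact integral operators on `Lᵖ(ν)` for every `1 < p < ∞`, and the
essential infima of `N_ε(ξ) = ∫ K_ε(ξ,ω) dν(ω)` tend to `∞` as `ε → 0⁺`. -/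
theorem cutoff_kernel_operators_compact_and_essInf_tendsto
    {Z : Type*} [MetricSpace Z] [MeasurableSpace Z] [BorelSpace Z]
    (ν : Measure Z) (D : ℝ) (hD : 0 < D)
    (hbdd : Bornology.IsBounded (Set.univ : Set Z))
    (hdiam : 0 < diam (Set.univ : Set Z))
    (c C : ℝ) (hc : 0 < c) (hc1 : c ≤ 1) (hC : 1 ≤ C)
    (hlow : ∀ (ξ : Z) (r : ℝ), 0 ≤ r → r ≤ diam (Set.univ : Set Z) →
      ENNReal.ofReal (c * r ^ D) ≤ ν (closedBall ξ r))
    (hupp : ∀ (ξ : Z) (r : ℝ), 0 ≤ r → r ≤ diam (Set.univ : Set Z) →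
      ν (closedBall ξ r) ≤ ENNReal.ofReal (C * r ^ D)) :
    (∀ (p : ℝ), 1 < p → ∀ (inst : Fact (1 ≤ ENNReal.ofReal p)) (ε : ℝ), 0 < ε →
      ∃ T : Lp ℂ (ENNReal.ofReal p) ν →L[ℂ] Lp ℂ (ENNReal.ofReal p) ν,
        IsCompactOperator (T : Lp ℂ (ENNReal.ofReal p) ν → Lp ℂ (ENNReal.ofReal p) ν) ∧
        ∀ φ : Lp ℂ (ENNReal.ofReal p) ν, ∀ᵐ ξ ∂ν,
          (T φ : Z → ℂ) ξ
            = ∫ ω, (if ε < dist ξ ω then ((edist ξ ω) ^ (-D)).toReal else 0)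
                • (φ : Z → ℂ) ω ∂ν) ∧
    Tendsto
      (fun ε : ℝ => essInf
        (fun ξ => ∫⁻ ω, (if ε < dist ξ ω then (edist ξ ω) ^ (-D) else 0) ∂ν) ν)
      (𝓝[>] (0 : ℝ)) (nhds ⊤) := by
  set R := diam (Set.univ : Set Z) with hR
  have hball : ∀ ξ : Z, closedBall ξ R = Set.univ := fun ξ =>
    Set.eq_univ_of_forall fun ω => dist_le_diam_of_mem hbdd (Set.mem_univ _) (Set.mem_univ _)
  obtain ⟨ξ₀⟩ : Nonempty Z := by
    by_contra h
    rw [not_nonempty_iff] at h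
    simp [hR, Set.univ_eq_empty_iff.2 h] at hdiam
  have hfin : IsFiniteMeasure ν := ⟨by
    rw [← hball ξ₀]
    exact (hupp ξ₀ R hdiam.le le_rfl).trans_lt ENNReal.ofReal_lt_top⟩
  have hpos : ∀ (x : Z) (r : ℝ), 0 < r → 0 < ν (closedBall x r) := fun x r hr => by
    have hm : 0 < min r R := lt_min hr hdiam
    refine lt_of_lt_of_le (ENNReal.ofReal_pos.2 (by positivity))
      ((hlow x (min r R) hm.le (min_le_right _ _)).trans
        (measure_mono (closedBall_subset_closedBall (min_le_left _ _))))
  have := secondCountableTopology_of_measure_closedBall_pos ν hpos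
  refine ⟨fun p hp inst ε hε => ?_, ?_⟩
  · have hpq := Real.HolderConjugate.conjExponent hp
    set q := p.conjExponent
    have hq1 : Fact (1 ≤ ENNReal.ofReal q) := ⟨ENNReal.one_le_ofReal.2 hpq.symm.lt.le⟩
    have := hpq.ennrealOfReal
    exact exists_compactOperator_of_bounded_kernel (q := ENNReal.ofReal q) ENNReal.ofReal_ne_top
      ENNReal.ofReal_ne_top _ (measurable_uncurry_truncated_kernel D ε) _
      (abs_truncated_kernel_le hD hε)
  · set L := (2 * C / c) ^ D⁻¹ with hLdef
    have hq : 1 ≤ 2 * C / c := by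
      rw [one_le_div hc]
      linarith
    have hL : 1 ≤ L := Real.one_le_rpow hq (by positivity)
    have hLD : 2 * C ≤ c * L ^ D := by
      rw [hLdef, Real.rpow_inv_rpow (by positivity) hD.ne', mul_div_cancel₀ _ hc.ne']
    refine ENNReal.tendsto_nhds_top fun n => ?_
    obtain ⟨m, hm⟩ := exists_nat_gt (n / (c / 2))
    have hRm : 0 < R / L ^ m := by
      have := one_pos.trans_le hL
      positivity
    filter_upwards [Ioo_mem_nhdsGT hRm] with ε hε
    refine lt_of_lt_of_le (b := ENNReal.ofReal (m * (c / 2))) ?_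
      (le_essInf_of_ae_le _ (.of_forall fun ξ => ?_))
    · rw [← ENNReal.ofReal_natCast]
      rw [div_lt_iff₀ (by positivity)] at hm
      exact (ENNReal.ofReal_lt_ofReal_iff_of_nonneg (Nat.cast_nonneg _)).2 hm
    · refine (natCast_mul_le_lintegral_truncated_kernel hD hc (by linarith) hdiam hL hLD
        (hlow ξ) (hupp ξ) m).trans (lintegral_mono fun ω => ?_)
      dsimp only
      split_ifs with h1 h2
      · exact le_rfl
      · exact absurd (hε.2.trans h1) h2
      all_goals simp
end
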